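/- For every k ≥ 1, there is a bijection between the set of all Schröder paths (of arbitrary semilength) consisting of exactly k steps and the set MP(k) of Motzkin paths of length k. In particular, the number of Schröder paths with exactly k steps is the k-th Motzkin number. -/

import Mathlib

/-! Schröder paths -/

inductive SStep : Type
  | H | V | D
deriving DecidableEq

def SStep.dx : SStep → ℕ
  | .H => 1 | .V => 0 | .D => 1

def SStep.dy : SStep → ℕ
  | .H => 0 | .V => 1 | .D => 1

def pathX (p : List SStep) : ℕ := (p.map SStep.dx).sum
def pathY (p : List SStep) : ℕ := (p.map SStep.dy).sum

/-- A Schröder path of semilength `n`: from (0,0) to (n,n), steps H,V,D,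
never rising above the diagonal. -/
def IsSchroder (n : ℕ) (p : List SStep) : Prop :=
  pathX p = n ∧ pathY p = n ∧ ∀ q : List SStep, q <+: p → pathY q ≤ pathX q

/-- No diagonal step starts on the diagonal. -/
def DiagFree (p : List SStep) : Prop :=
  ∀ q r : List SStep, p = q ++ SStep.D :: r → pathX q ≠ pathY q

/-- Every diagonal step is immediately followed by a horizontal step,
except if it is the last step. -/
def DFollowedByH (p : List SStep) : Prop :=
  ∀ q r : List SStep, p = q ++ SStep.D :: r → r = [] ∨ ∃ r' : List SStep, r = SStep.H :: r'

def SP (n m : ℕ) : Type := {p : List SStep // IsSchroder n p ∧ p.count SStep.D + m = n}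
def SPplus (n m : ℕ) : Type :=
  {p : List SStep // IsSchroder n p ∧ p.count SStep.D + m = n ∧ DiagFree p}
def SPzero (n m : ℕ) : Type :=
  {p : List SStep // IsSchroder n p ∧ p.count SStep.D + m = n ∧ ¬ DiagFree p}
def RP (n m : ℕ) : Type :=
  {p : List SStep // IsSchroder n p ∧ p.count SStep.D + m = n ∧ DFollowedByH p}

/-! Rooted planar trees -/

inductive PTree : Type
  | node : List PTree → PTree

namespace PTree

def leaves : PTree → ℕ
  | node [] => 1
  | node (c :: cs) => ((c :: cs).attach.map fun x => leaves x.1).sum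
decreasing_by
  have := List.sizeOf_lt_of_mem x.2
  simp only [PTree.node.sizeOf_spec, List.cons.sizeOf_spec] at this ⊢
  omega

def internal : PTree → ℕ
  | node [] => 0
  | node (c :: cs) => 1 + ((c :: cs).attach.map fun x => internal x.1).sum
decreasing_by
  have := List.sizeOf_lt_of_mem x.2
  simp only [PTree.node.sizeOf_spec, List.cons.sizeOf_spec] at this ⊢
  omega

def Good : PTree → Prop
  | node cs => cs.length ≠ 1 ∧ ∀ c ∈ cs.attach, Good c.1
decreasing_by
  have := List.sizeOf_lt_of_mem c.2
  simp only [PTree.node.sizeOf_spec] at this ⊢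
  omega

end PTree

def PT (n m : ℕ) : Type :=
  {t : PTree // t.Good ∧ t.leaves = n + 1 ∧ t.internal = m}

def PTn (n : ℕ) : Type := {t : PTree // t.Good ∧ t.leaves = n + 1}

/-! Motzkin paths -/

inductive MStep : Type
  | U | H | D
deriving DecidableEq

def MStep.dh : MStep → ℤ
  | .U => 1 | .H => 0 | .D => -1

def mHeight (p : List MStep) : ℤ := (p.map MStep.dh).sum

def IsMotzkin (k : ℕ) (p : List MStep) : Prop :=
  p.length = k ∧ mHeight p = 0 ∧ ∀ q : List MStep, q <+: p → 0 ≤ mHeight q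

def HFollowedByU (p : List MStep) : Prop :=
  ∀ q r : List MStep, p = q ++ MStep.H :: r → r = [] ∨ ∃ r' : List MStep, r = MStep.U :: r'

def MP (k : ℕ) : Type := {p : List MStep // IsMotzkin k p}
def RMP (k : ℕ) : Type := {p : List MStep // IsMotzkin k p ∧ HFollowedByU p}

/-- Motzkin steps with two possible colors on up and horizontal steps. -/
inductive CMStep : Type
  | U : Bool → CMStep
  | H : Bool → CMStep
  | D : CMStep
deriving DecidableEq

def CMStep.forget : CMStep → MStep
  | .U _ => .U | .H _ => .H | .D => .D

/-- (h,u)-colored Motzkin paths of length n-1. -/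
def huMP (n : ℕ) : Type := {p : List CMStep // IsMotzkin (n - 1) (p.map CMStep.forget)}


/-- Schröder paths (of arbitrary semilength) with exactly k steps. -/
def SchroderWithSteps (k : ℕ) : Type :=
  {p : List SStep // (∃ n : ℕ, IsSchroder n p) ∧ p.length = k}

def SStep.equivMStep : SStep ≃ MStep where
  toFun
    | .H => .U
    | .V => .D
    | .D => .H
  invFun
    | .U => .H
    | .D => .V
    | .H => .D
  left_inv s := by cases s <;> rfl
  right_inv s := by cases s <;> rfl

theorem SStep.dh_equivMStep (s : SStep) : (SStep.equivMStep s).dh = (s.dx : ℤ) - s.dy := by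
  cases s <;> rfl

theorem mHeight_map_equivMStep (p : List SStep) :
    mHeight (p.map SStep.equivMStep) = (pathX p : ℤ) - pathY p := by
  induction p with
  | nil => rfl
  | cons s p ih =>
    simp only [mHeight, pathX, pathY, List.map_cons, List.sum_cons, SStep.dh_equivMStep,
      Nat.cast_add] at ih ⊢
    omega

theorem exists_isSchroder_iff (p : List SStep) :
    (∃ n, IsSchroder n p) ↔ pathX p = pathY p ∧ ∀ q, q <+: p → pathY q ≤ pathX q := by
  constructor
  · rintro ⟨n, hx, hy, h⟩
    exact ⟨hx.trans hy.symm, h⟩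
  · rintro ⟨hxy, h⟩
    exact ⟨pathX p, rfl, hxy.symm, h⟩

theorem isMotzkin_map_equivMStep_iff (k : ℕ) (p : List SStep) :
    IsMotzkin k (p.map SStep.equivMStep) ↔ (∃ n, IsSchroder n p) ∧ p.length = k := by
  rw [exists_isSchroder_iff, IsMotzkin, List.length_map, mHeight_map_equivMStep, sub_eq_zero,
    Nat.cast_inj, and_comm (b := p.length = k)]
  refine and_congr_right fun _ => and_congr_right fun _ => ?_
  simp only [List.prefix_map_iff, forall_exists_index, and_imp]
  constructor
  · intro h q hq
    have := h _ q hq rfl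
    rw [mHeight_map_equivMStep] at this
    omega
  · rintro h _ q hq rfl
    have := h q hq
    rw [mHeight_map_equivMStep]
    omega

def schroderWithStepsEquivMP (k : ℕ) : SchroderWithSteps k ≃ MP k :=
  (Equiv.listEquivOfEquiv SStep.equivMStep).subtypeEquiv fun p =>
    (isMotzkin_map_equivMStep_iff k p).symm

/-- the Schröder paths with exactly k steps are in bijection with
Motzkin paths of length k; in particular their number is the k-th Motzkin number. -/
theorem statement9 (k : ℕ) (hk : 1 ≤ k) :
    Nonempty (SchroderWithSteps k ≃ MP k) ∧
      Nat.card (SchroderWithSteps k) = Nat.card (MP k) :=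
  ⟨⟨schroderWithStepsEquivMP k⟩, Nat.card_congr (schroderWithStepsEquivMP k)⟩
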